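/- (Cartan-direction bound in type A.) Fix n ≥ 2 and a field 𝐤. Let λ, μ ∈ ℤ^n be weakly decreasing with λ ≼ μ, i.e. Σ_i λ_i = Σ_i μ_i and λ_1 + ⋯ + λ_i ≤ μ_1 + ⋯ + μ_i for all i. For 1 ≤ i ≤ n−1 set k_{−α_i} = max{ k ∈ ℤ : (λ + k(e_i − e_{i+1}))_dom ≼ μ }, where x_dom denotes the weakly decreasing rearrangement of x. Let m_1, …, m_{n−1} ∈ 𝐤, not all zero, and define l_H as the minimum of μ·ϖ − λ·ϖ′ over all pairs (ϖ, ϖ′) with ϖ ∈ ℤ^n weakly decreasing, ϖ′ ∈ ℤ^n, Σ_i ϖ′_i = Σ_i ϖ_i, (ϖ′)_dom ≼ ϖ, and such that Σ_{i=1}^{n−1} m_i · (ϖ′_i − ϖ′_{i+1}) ≠ 0 in 𝐤 (integers mapped to 𝐤 via the canonical ring map). Then l_H = min{ k_{−α_i} : 1 ≤ i ≤ n−1, m_i ≠ 0 }. -/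

import Mathlib

open Finset

/-- `x` is weakly decreasing (a dominant weight of `GL_n`). -/
def WD {n : ℕ} (x : Fin n → ℤ) : Prop := ∀ i j : Fin n, i ≤ j → x j ≤ x i

/-- The dominance order on weakly decreasing integer vectors: equal coordinate sums and
`x_1 + ⋯ + x_i ≤ y_1 + ⋯ + y_i` for all `i`. -/
def DomLE {n : ℕ} (x y : Fin n → ℤ) : Prop :=
  (∑ i, x i) = (∑ i, y i) ∧
    ∀ k : Fin n, (∑ i ∈ univ.filter (· ≤ k), x i) ≤ ∑ i ∈ univ.filter (· ≤ k), y i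

/-- The weakly decreasing rearrangement `x_dom` of `x` satisfies `x_dom ≼ μ`;
equivalently, some rearrangement of `x` is weakly decreasing and `≼ μ`. -/
def DomRearrLE {n : ℕ} (x μ : Fin n → ℤ) : Prop :=
  ∃ σ : Equiv.Perm (Fin n), WD (x ∘ σ) ∧ DomLE (x ∘ σ) μ

/-- the standard dot product -/
def dotP {n : ℕ} (x y : Fin n → ℤ) : ℤ := ∑ i, x i * y i

/-- the index `i` of `{1, …, n-1}` viewed in `{1, …, n}` -/
def idxA {n : ℕ} (i : Fin (n - 1)) : Fin n := ⟨i.1, by have := i.2; omega⟩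

/-- the index `i + 1` of `{1, …, n}`, for `i` in `{1, …, n-1}` -/
def idxB {n : ℕ} (i : Fin (n - 1)) : Fin n := ⟨i.1 + 1, by have := i.2; omega⟩

/-- the simple coroot `α_i^∨ = e_i - e_{i+1}` of `GL_n` -/
def delta {n : ℕ} (i : Fin (n - 1)) : Fin n → ℤ := fun j =>
  (if j = idxA i then 1 else 0) - (if j = idxB i then 1 else 0)

/-! ### Sums over initial segments -/

theorem exists_nat_extension {n : ℕ} {A : Type*} [Zero A] (x : Fin n → A) :
    ∃ y : ℕ → A, ∀ a : Fin n, x a = y a :=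
  ⟨fun t => if h : t < n then x ⟨t, h⟩ else 0, fun a => by simp⟩

theorem sum_filter_le_eq_sum_range {n : ℕ} {A : Type*} [AddCommMonoid A] (y : ℕ → A)
    (k : Fin n) :
    ∑ i ∈ univ.filter (· ≤ k), y i = ∑ t ∈ range (k.1 + 1), y t := by
  refine Finset.sum_bij (fun a _ => a.1) ?_ ?_ ?_ ?_
  · intro a ha
    simp only [mem_filter, mem_univ, true_and, Fin.le_def] at ha
    simp only [mem_range]
    omega
  · intro a _ b _ hab
    exact Fin.ext hab
  · intro b hb
    simp only [mem_range] at hb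
    refine ⟨⟨b, by omega⟩, ?_, rfl⟩
    simp only [mem_filter, mem_univ, true_and, Fin.le_def]
    omega
  · intro a _
    rfl

/-- Abel summation: a vector whose proper initial sums are nonnegative pairs nonnegatively with
weakly decreasing vectors, up to a boundary term. -/
theorem mul_last_le_sum_mul (e c : ℕ → ℤ) (k : ℕ)
    (he : ∀ t < k, 0 ≤ ∑ s ∈ range (t + 1), e s) (hc : ∀ t < k, c (t + 1) ≤ c t) :
    (∑ s ∈ range (k + 1), e s) * c k ≤ ∑ s ∈ range (k + 1), e s * c s := by
  induction k with
  | zero => simp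
  | succ k ih =>
    have h := ih (fun t ht => he t (by omega)) (fun t ht => hc t (by omega))
    rw [sum_range_succ e (k + 1), sum_range_succ (fun s => e s * c s) (k + 1)]
    nlinarith [mul_nonneg (he k (by omega)) (sub_nonneg.2 (hc k (by omega)))]

theorem dotP_comm {n : ℕ} (x y : Fin n → ℤ) : dotP x y = dotP y x :=
  Finset.sum_congr rfl fun _ _ => mul_comm _ _

theorem DomLE.dotP_le {n : ℕ} {a b c : Fin n → ℤ} (hab : DomLE a b) (hc : WD c) :
    dotP a c ≤ dotP b c := by
  obtain ⟨x, hx⟩ := exists_nat_extension a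
  obtain ⟨y, hy⟩ := exists_nat_extension b
  obtain ⟨z, hz⟩ := exists_nat_extension c
  obtain ⟨hsum, hpart⟩ := hab
  rcases n with _ | n
  · simp [dotP]
  simp only [hx, hy] at hsum hpart
  rw [Fin.sum_univ_eq_sum_range, Fin.sum_univ_eq_sum_range] at hsum
  simp only [dotP, hx, hy, hz]
  rw [Fin.sum_univ_eq_sum_range (fun t => x t * z t),
    Fin.sum_univ_eq_sum_range (fun t => y t * z t)]
  have h := mul_last_le_sum_mul (fun t => y t - x t) z n ?_ ?_
  · simp only [sum_sub_distrib, sub_mul] at h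
    linarith [congrArg (· * z n) hsum]
  · intro t ht
    have h := hpart ⟨t, by omega⟩
    rw [sum_filter_le_eq_sum_range, sum_filter_le_eq_sum_range] at h
    simp only [sum_sub_distrib]
    linarith
  · intro t ht
    have h := hc ⟨t, by omega⟩ ⟨t + 1, by omega⟩ (by simp [Fin.le_def])
    simpa only [hz] using h

theorem DomRearrLE.dotP_le {n : ℕ} {x y a b : Fin n → ℤ} (hx : DomRearrLE x a) (ha : WD a)
    (hy : DomRearrLE y b) : dotP x y ≤ dotP a b := by
  obtain ⟨σ, hσ, hσa⟩ := hx
  obtain ⟨τ, hτ, hτb⟩ := hy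
  calc dotP x y = ∑ i, (x ∘ σ) i * (y ∘ τ) ((σ.trans τ.symm) i) := by
        rw [dotP, ← Equiv.sum_comp σ]
        simp
    _ ≤ dotP (x ∘ σ) (y ∘ τ) := by
        refine Monovary.sum_mul_comp_perm_le_sum_mul ?_
        intro i j hij
        rcases le_total i j with h | h
        · exact absurd (hτ i j h) (not_le.2 hij)
        · exact hσ j i h
    _ ≤ dotP a (y ∘ τ) := hσa.dotP_le hτ
    _ ≤ dotP a b := by
        rw [dotP_comm a, dotP_comm a]
        exact hτb.dotP_le ha

theorem exists_perm_WD {n : ℕ} (x : Fin n → ℤ) : ∃ σ : Equiv.Perm (Fin n), WD (x ∘ σ) := by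
  refine ⟨Tuple.sort (fun i => -x i), fun i j hij => ?_⟩
  have h := Tuple.monotone_sort (fun i => -x i) hij
  simpa using h

/-! ### Subset sums -/

theorem sum_le_sum_range_card {n : ℕ} {l : ℕ → ℤ} (hl : ∀ s t, s ≤ t → t < n → l t ≤ l s)
    (S : Finset ℕ) (hS : S ⊆ range n) : ∑ t ∈ S, l t ≤ ∑ t ∈ range #S, l t := by
  induction S using Finset.induction_on_max with
  | empty => simp
  | insert a S ha ih =>
    have haS : a ∉ S := fun h => lt_irrefl _ (ha a h)
    have hcard : #S ≤ a := by
      simpa using card_le_card (show S ⊆ range a from fun s hs => mem_range.2 (ha s hs))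
    rw [sum_insert haS, card_insert_of_notMem haS, sum_range_succ]
    have h := ih ((subset_insert a S).trans hS)
    have h' := hl _ _ hcard (mem_range.1 (hS (mem_insert_self a S)))
    linarith

/-- Give a set `T` of positions the cost `∑_{t < #T} u t - ∑_{t ∈ T} l t`.  If some set of cost at
most `L` contains `i` but not `i + 1`, and `h` has nonzero sum on `{0, …, i}`, then `h` has
nonzero sum on some set of cost at most `L`. -/
theorem exists_subset_cost_le_sum_ne_zero {𝕜 : Type*} [Field 𝕜] {n : ℕ} {l u : ℕ → ℤ}
    (hl : ∀ s t, s ≤ t → t < n → l t ≤ l s) (hu : ∀ s t, s ≤ t → t < n → u t ≤ u s)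
    (h : ℕ → 𝕜) (L : ℤ) {S : Finset ℕ} (hS : S ⊆ range n) {i : ℕ} (hi : i + 1 < n)
    (hiS : i ∈ S) (hiS' : i + 1 ∉ S) (hsum : ∑ t ∈ range (i + 1), h t ≠ 0)
    (hcost : ∑ t ∈ range #S, u t - ∑ t ∈ S, l t ≤ L) :
    ∃ T ⊆ range n, ∑ t ∈ range #T, u t - ∑ t ∈ T, l t ≤ L ∧ ∑ t ∈ T, h t ≠ 0 := by
  by_contra! hno
  have hSpos : 0 < #S := card_pos.2 ⟨i, hiS⟩
  obtain ⟨p, hp⟩ : ∃ p, #S = p + 1 := ⟨#S - 1, by omega⟩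
  have hins : insert (i + 1) S ⊆ range n :=
    insert_subset (mem_range.2 hi) hS
  have hinscard : #(insert (i + 1) S) = p + 2 := by
    rw [card_insert_of_notMem hiS', hp]
  have hpn : p + 2 ≤ n := by
    have := card_le_card hins
    rwa [hinscard, card_range] at this
  -- initial segments
  have hseg : ∀ j ≤ n, ∑ t ∈ range j, u t - ∑ t ∈ range j, l t ≤ L →
      ∑ t ∈ range j, h t = 0 := by
    intro j hj hc
    exact hno (range j) (range_subset_range.2 hj) (by simpa using hc)
  -- an initial segment together with one more element
  have hadd : ∀ a, p ≤ a → a < n → ∑ t ∈ S, l t ≤ ∑ t ∈ range p, l t + l a →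
      ∑ t ∈ range p, h t + h a = 0 := by
    intro a hpa han hc
    have hnot : a ∉ range p := by simpa using hpa
    have := hno (insert a (range p))
      (insert_subset (mem_range.2 han) (range_subset_range.2 (by omega))) (by
        rw [card_insert_of_notMem hnot, sum_insert hnot, card_range, ← hp]
        linarith)
    rw [sum_insert hnot] at this
    linear_combination this
  -- an initial segment with one element removed
  have hdel : ∀ a, a < p + 2 → ∑ t ∈ S, l t ≤ ∑ t ∈ range (p + 2), l t - l a →
      ∑ t ∈ range (p + 2), h t - h a = 0 := by
    intro a ha hc
    have hmem : a ∈ range (p + 2) := mem_range.2 ha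
    have h1 := sum_erase_add (range (p + 2)) l hmem
    have h2 := sum_erase_add (range (p + 2)) h hmem
    have := hno ((range (p + 2)).erase a)
      ((erase_subset _ _).trans (range_subset_range.2 hpn)) (by
        rw [card_erase_of_mem hmem, card_range, show p + 2 - 1 = #S by omega]
        linarith)
    linear_combination this - h2
  have hfull : ∑ t ∈ range (p + 1), h t = 0 := by
    refine hseg _ (by omega) ?_
    have := sum_le_sum_range_card hl S hS
    rw [hp] at this hcost
    linarith
  -- the key estimate coming from dominance of `u`
  have hkey : ∑ t ∈ range p, h t ≠ 0 → ∑ t ∈ range (p + 2), h t ≠ 0 →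
      ∑ t ∈ S, l t ≤ ∑ t ∈ range p, l t + l (p + 1) → False := by
    intro h1 h2 h3
    have h4 := mt (hseg p (by omega)) h1
    have h5 := mt (hseg (p + 2) hpn) h2
    have h6 := hu p (p + 1) (by omega) (by omega)
    have h7 := hl p (p + 1) (by omega) (by omega)
    rw [hp] at hcost
    simp only [sum_range_succ] at hcost h4 h5
    linarith
  rcases lt_trichotomy (p + 1) (i + 1) with hlt | heq | hgt
  · have hle : ∀ a, p ≤ a → a ≤ i → ∑ t ∈ S, l t ≤ ∑ t ∈ range p, l t + l a := by
      intro a _ hai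
      have h1 := sum_le_sum_range_card hl (S.erase i) ((erase_subset _ _).trans hS)
      rw [card_erase_of_mem hiS, hp] at h1
      have h2 := sum_erase_add S l hiS
      have h3 := hl a i hai (by omega)
      simp only [Nat.add_sub_cancel] at h1
      linarith
    have hval : ∀ a, p ≤ a → a ≤ i → h a = -∑ t ∈ range p, h t := fun a h1 h2 => by
      linear_combination hadd a h1 (by omega) (hle a h1 h2)
    have hne : ∑ t ∈ range p, h t ≠ 0 := by
      intro h0
      apply hsum
      rw [← sum_range_add_sum_Ico _ (show p ≤ i + 1 by omega), h0, zero_add]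
      refine sum_eq_zero fun a ha => ?_
      rw [mem_Ico] at ha
      rw [hval a ha.1 (by omega), h0, neg_zero]
    refine hkey hne ?_ (hle _ (by omega) (by omega))
    rw [sum_range_succ, hfull, hval (p + 1) (by omega) (by omega)]
    simpa using hne
  · exact hsum (heq ▸ hfull)
  · have hle : ∀ a, i + 1 ≤ a → a < p + 2 → ∑ t ∈ S, l t ≤ ∑ t ∈ range (p + 2), l t - l a := by
      intro a hai hap
      have h1 := sum_le_sum_range_card hl _ hins
      rw [hinscard, sum_insert hiS'] at h1
      have h3 := hl (i + 1) a hai (by omega)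
      linarith
    have hval : ∀ a, i + 1 ≤ a → a < p + 2 → h a = ∑ t ∈ range (p + 2), h t :=
      fun a h1 h2 => by
        linear_combination -hdel a h2 (hle a h1 h2)
    have hne : ∑ t ∈ range (p + 2), h t ≠ 0 := by
      intro h0
      apply hsum
      rw [← sum_range_add_sum_Ico _ (show i + 1 ≤ p + 2 by omega)] at h0
      rw [sum_eq_zero (s := Ico (i + 1) (p + 2)), add_zero] at h0
      · exact h0
      · intro a ha
        rw [mem_Ico] at ha
        rw [hval a ha.1 ha.2, ← sum_range_add_sum_Ico _ (show i + 1 ≤ p + 2 by omega), h0]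
    refine hkey ?_ hne ?_
    · have h1 := hval p (by omega) (by omega)
      rw [sum_range_succ, h1] at hfull
      intro h0
      rw [h0, zero_add] at hfull
      exact hne hfull
    · have h1 := hle p (by omega) (by omega)
      simp only [sum_range_succ] at h1 ⊢
      linarith

/-! ### Indicator vectors -/

/-- The indicator vector of a set of positions. -/
def indicatorVec (n : ℕ) (T : Finset ℕ) : Fin n → ℤ := fun a => if a.1 ∈ T then 1 else 0

theorem sum_mul_indicatorVec {n : ℕ} {A : Type*} [CommRing A] {T : Finset ℕ} (hT : T ⊆ range n)
    (y : ℕ → A) : ∑ a : Fin n, y a * (indicatorVec n T a : A) = ∑ t ∈ T, y t := by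
  simp only [indicatorVec]
  rw [Fin.sum_univ_eq_sum_range (fun t => y t * (((if t ∈ T then 1 else 0 : ℤ)) : A))]
  simp only [Int.cast_ite, Int.cast_one, Int.cast_zero, mul_ite, mul_one, mul_zero]
  rw [← sum_filter, filter_mem_eq_inter, inter_eq_right.2 hT]

theorem sum_indicatorVec {n : ℕ} {T : Finset ℕ} (hT : T ⊆ range n) :
    ∑ a : Fin n, indicatorVec n T a = #T := by
  simpa using sum_mul_indicatorVec (A := ℤ) hT (fun _ => 1)

theorem WD_indicatorVec_range (n k : ℕ) : WD (indicatorVec n (range k)) := by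
  intro i j hij
  rw [Fin.le_def] at hij
  simp only [indicatorVec, mem_range]
  split_ifs <;> omega

theorem domRearrLE_indicatorVec {n : ℕ} {T : Finset ℕ} (hT : T ⊆ range n) :
    DomRearrLE (indicatorVec n T) (indicatorVec n (range #T)) := by
  have hTn : #T ≤ n := by simpa using card_le_card hT
  obtain ⟨σ, hσ⟩ := exists_perm_WD (indicatorVec n T)
  refine ⟨σ, hσ, ?_, fun k => ?_⟩
  · rw [sum_indicatorVec (range_subset_range.2 hTn), card_range]
    simp only [Function.comp_apply]
    rw [Equiv.sum_comp σ, sum_indicatorVec hT]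
  · have hnn : ∀ a, 0 ≤ (indicatorVec n T ∘ σ) a := by
      intro a
      simp only [indicatorVec, Function.comp_apply]
      split_ifs <;> simp
    have hle1 : ∀ a, (indicatorVec n T ∘ σ) a ≤ 1 := by
      intro a
      simp only [indicatorVec, Function.comp_apply]
      split_ifs <;> simp
    have h1 : ∑ i ∈ univ.filter (· ≤ k), (indicatorVec n T ∘ σ) i ≤ #T := by
      rw [← sum_indicatorVec hT, ← Equiv.sum_comp σ]
      exact sum_le_sum_of_subset_of_nonneg (filter_subset _ _) fun a _ _ => hnn a
    have h2 : ∑ i ∈ univ.filter (· ≤ k), (indicatorVec n T ∘ σ) i ≤ (k.1 + 1 : ℕ) := by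
      refine (sum_le_sum fun a _ => hle1 a).trans ?_
      rw [sum_filter_le_eq_sum_range (fun _ => (1 : ℤ)) k]
      simp
    have h3 : ∑ i ∈ univ.filter (· ≤ k), indicatorVec n (range #T) i
        = (#(range (k.1 + 1) ∩ range #T) : ℤ) := by
      simp only [indicatorVec]
      rw [sum_filter_le_eq_sum_range (fun t => if t ∈ range #T then (1 : ℤ) else 0) k,
        ← sum_filter, filter_mem_eq_inter]
      simp
    rw [h3]
    rcases le_total (k.1 + 1) #T with h | h
    · rwa [inter_eq_left.2 (range_subset_range.2 h), card_range]
    · rwa [inter_eq_right.2 (range_subset_range.2 h), card_range]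

/-! ### Perturbing by a simple coroot -/

theorem sum_mul_delta {n : ℕ} (i : Fin (n - 1)) (y : Fin n → ℤ) :
    ∑ a, delta i a * y a = y (idxA i) - y (idxB i) := by
  simp [delta, sub_mul, sum_sub_distrib]

theorem dotP_add_smul_delta {n : ℕ} (x y : Fin n → ℤ) (c : ℤ) (i : Fin (n - 1)) :
    dotP (x + c • delta i) y = dotP x y + c * (y (idxA i) - y (idxB i)) := by
  rw [← sum_mul_delta, mul_sum, dotP, dotP, ← sum_add_distrib]
  refine sum_congr rfl fun a _ => ?_
  simp only [Pi.add_apply, Pi.smul_apply, smul_eq_mul]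
  ring

theorem DomRearrLE.comp_perm {n : ℕ} {x a : Fin n → ℤ} (h : DomRearrLE x a)
    (τ : Equiv.Perm (Fin n)) : DomRearrLE (x ∘ τ) a := by
  obtain ⟨σ, hσ⟩ := h
  refine ⟨σ.trans τ.symm, ?_⟩
  have : (x ∘ τ) ∘ (σ.trans τ.symm) = x ∘ σ := by
    ext
    simp
  rwa [this]

theorem comp_swap_eq_add_smul_delta {n : ℕ} (y : Fin n → ℤ) (i : Fin (n - 1)) :
    y ∘ Equiv.swap (idxA i) (idxB i) = y + (y (idxB i) - y (idxA i)) • delta i := by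
  have hne : idxA i ≠ idxB i := by simp [idxA, idxB]
  ext a
  simp only [Function.comp_apply, Pi.add_apply, Pi.smul_apply, smul_eq_mul, delta,
    Equiv.swap_apply_def]
  by_cases h1 : a = idxA i
  · simp [h1, hne]
  · by_cases h2 : a = idxB i
    · simp [h2, hne.symm]
    · simp [h1, h2]

/-- If `(λ + k α_i)_dom ≼ μ` with `k ≥ 0`, then every weight of `V(ϖ)` on which `H_{α_i}` has a
nonzero integral eigenvalue has cost at least `k`. -/
theorem le_dotP_sub_dotP {n : ℕ} {lam mu y b : Fin n → ℤ} (hlam : WD lam) (hmu : WD mu) {k : ℤ}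
    (hk : 0 ≤ k) {i : Fin (n - 1)} (hx : DomRearrLE (lam + k • delta i) mu)
    (hy : DomRearrLE y b) (hne : y (idxA i) ≠ y (idxB i)) : k ≤ dotP mu b - dotP lam y := by
  rcases lt_or_gt_of_ne hne with hlt | hgt
  · have h1 := hx.dotP_le hmu (hy.comp_perm (Equiv.swap (idxA i) (idxB i)))
    rw [dotP_add_smul_delta] at h1
    simp only [Function.comp_apply, Equiv.swap_apply_left, Equiv.swap_apply_right] at h1
    rw [comp_swap_eq_add_smul_delta, dotP_comm lam, dotP_add_smul_delta, dotP_comm y] at h1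
    have h2 : lam (idxB i) ≤ lam (idxA i) := hlam _ _ (by simp [idxA, idxB])
    nlinarith [mul_nonneg (sub_nonneg.2 hlt.le) (sub_nonneg.2 h2),
      mul_nonneg hk (show 0 ≤ y (idxB i) - y (idxA i) - 1 by omega)]
  · have h1 := hx.dotP_le hmu hy
    rw [dotP_add_smul_delta] at h1
    nlinarith [mul_nonneg hk (show 0 ≤ y (idxA i) - y (idxB i) - 1 by omega)]

theorem exists_sum_lt_of_not_domRearrLE {n : ℕ} {x a : Fin n → ℤ} (hsum : ∑ i, x i = ∑ i, a i)
    (h : ¬ DomRearrLE x a) : ∃ (S : Finset (Fin n)) (k : Fin n), #S = k.1 + 1 ∧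
      ∑ i ∈ univ.filter (· ≤ k), a i < ∑ i ∈ S, x i := by
  obtain ⟨σ, hσ⟩ := exists_perm_WD x
  by_contra! hno
  refine h ⟨σ, hσ, ?_, fun k => ?_⟩
  · rw [← hsum]
    exact Equiv.sum_comp σ x
  · have h1 := hno ((univ.filter (· ≤ k)).map σ.toEmbedding) k (by
      rw [card_map, card_eq_sum_ones, sum_filter_le_eq_sum_range (fun _ => 1)]
      simp)
    rwa [sum_map] at h1

/-- If `(λ + (k + 1) α_i)_dom ⋠ μ`, then some weight of a fundamental representation, on which
`H_{α_i}` has eigenvalue one, has cost at most `k`. -/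
theorem exists_subset_cost_le {n : ℕ} {lam mu : Fin n → ℤ} (hlam : WD lam) (hle : DomLE lam mu)
    {l u : ℕ → ℤ} (hl : ∀ a, lam a = l a) (hu : ∀ a, mu a = u a) {k : ℤ} (hk : 0 ≤ k)
    {i : Fin (n - 1)} (hx : ¬ DomRearrLE (lam + (k + 1) • delta i) mu) :
    ∃ S ⊆ range n, i.1 ∈ S ∧ i.1 + 1 ∉ S ∧ ∑ t ∈ range #S, u t - ∑ t ∈ S, l t ≤ k := by
  have hsum : ∑ a, (lam + (k + 1) • delta i) a = ∑ a, mu a := by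
    have := sum_mul_delta i 1
    simp only [Pi.one_apply, mul_one, sub_self] at this
    simp [sum_add_distrib, ← mul_sum, this, hle.1]
  obtain ⟨S, j, hcard, hlt⟩ := exists_sum_lt_of_not_domRearrLE hsum hx
  have hsub : S.map Fin.valEmbedding ⊆ range n := by
    intro t ht
    obtain ⟨a, -, rfl⟩ := mem_map.1 ht
    exact mem_range.2 a.2
  have hmono : ∀ s t, s ≤ t → t < n → l t ≤ l s := fun s t hst ht => by
    have := hlam ⟨s, by omega⟩ ⟨t, ht⟩ hst
    simpa only [hl] using this
  have hdom := hle.2 j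
  simp only [hl, hu] at hdom
  rw [sum_filter_le_eq_sum_range, sum_filter_le_eq_sum_range] at hdom
  have hrearr := sum_le_sum_range_card hmono _ hsub
  have hdelta : ∑ a ∈ S, delta i a =
      (if idxA i ∈ S then 1 else 0) - (if idxB i ∈ S then 1 else 0) := by
    simp [delta, sum_sub_distrib]
  simp only [Pi.add_apply, Pi.smul_apply, smul_eq_mul, sum_add_distrib, ← mul_sum, hdelta, hl, hu]
    at hlt
  rw [sum_filter_le_eq_sum_range] at hlt
  simp only [card_map, hcard, sum_map, Fin.valEmbedding_apply] at hrearr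
  have hA : i.1 ∈ S.map Fin.valEmbedding ↔ idxA i ∈ S :=
    mem_map' (a := idxA i) Fin.valEmbedding
  have hB : i.1 + 1 ∈ S.map Fin.valEmbedding ↔ idxB i ∈ S :=
    mem_map' (a := idxB i) Fin.valEmbedding
  refine ⟨S.map Fin.valEmbedding, hsub, ?_⟩
  rw [hA, hB, card_map, hcard, sum_map]
  simp only [Fin.valEmbedding_apply]
  split_ifs at hlt with h1 h2 h2
  · linarith
  · exact ⟨h1, h2, by linarith⟩
  · linarith
  · linarith

/-- The eigenvalue of `∑ m_i H_{α_i}` on a weight, in terms of its coordinates. -/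
theorem exists_cartan_coordinates {n : ℕ} {𝕜 : Type*} [Field 𝕜] (m : Fin (n - 1) → 𝕜) :
    ∃ h : ℕ → 𝕜, ∀ y : Fin n → ℤ,
      ∑ i : Fin (n - 1), m i * ((y (idxA i) - y (idxB i) : ℤ) : 𝕜) = ∑ a : Fin n, h a * y a := by
  obtain ⟨h, hh⟩ := exists_nat_extension fun a : Fin n => ∑ i, m i * (delta i a : 𝕜)
  refine ⟨h, fun y => ?_⟩
  simp only [← hh, sum_mul]
  rw [sum_comm]
  refine sum_congr rfl fun i _ => ?_
  rw [← sum_mul_delta, Int.cast_sum, mul_sum]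
  exact sum_congr rfl fun a _ => by push_cast; ring

theorem sum_range_cartan_coordinates {n : ℕ} {𝕜 : Type*} [Field 𝕜] {m : Fin (n - 1) → 𝕜}
    {h : ℕ → 𝕜} (hh : ∀ y : Fin n → ℤ,
      ∑ i : Fin (n - 1), m i * ((y (idxA i) - y (idxB i) : ℤ) : 𝕜) = ∑ a : Fin n, h a * y a)
    (i : Fin (n - 1)) : ∑ t ∈ range (i.1 + 1), h t = m i := by
  rw [← sum_mul_indicatorVec (range_subset_range.2 (show i.1 + 1 ≤ n by omega)) h, ← hh,
    sum_eq_single i]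
  · simp [indicatorVec, idxA, idxB]
  · intro b _ hb
    have hb' : b.1 ≠ i.1 := fun h => hb (Fin.ext h)
    have : (b.1 < i.1 + 1 ↔ b.1 + 1 < i.1 + 1) := by omega
    simp [indicatorVec, idxA, idxB, -Order.lt_add_one_iff, this]
  · simp

/-- **Cartan-direction bound in type `A`.**  Let `λ ≼ μ` be weakly decreasing integer
vectors, `k_{-α_i} = max{k : (λ + k(e_i - e_{i+1}))_dom ≼ μ}`, and let `m_1, …, m_{n-1} ∈ 𝕜`,
not all zero.  Then the minimum `l_H` of `μ·ϖ - λ·ϖ'` over all pairs `(ϖ, ϖ')` with `ϖ`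
weakly decreasing, `ϖ'` a weight of the Weyl module `V(ϖ)` (i.e. `∑ϖ'ᵢ = ∑ϖᵢ` and
`(ϖ')_dom ≼ ϖ`) on whose weight space the Cartan element `H = ∑ m_i H_{α_i}` acts
nontrivially (i.e. `∑ m_i (ϖ'_i - ϖ'_{i+1}) ≠ 0` in `𝕜`) equals
`min{k_{-α_i} : m_i ≠ 0}`. -/
theorem statement9 (n : ℕ) (hn : 2 ≤ n) (𝕜 : Type*) [Field 𝕜]
    (lam mu : Fin n → ℤ) (hlam : WD lam) (hmu : WD mu) (hle : DomLE lam mu)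
    (m : Fin (n - 1) → 𝕜) (hm : ∃ i, m i ≠ 0)
    (kk : Fin (n - 1) → ℤ)
    (hkk : ∀ i, IsGreatest {k : ℤ | DomRearrLE (lam + k • delta i) mu} (kk i))
    (L : ℤ) (hL : IsLeast {z : ℤ | ∃ i, m i ≠ 0 ∧ z = kk i} L) :
    IsLeast {d : ℤ | ∃ ϖ ϖ' : Fin n → ℤ, WD ϖ ∧ (∑ i, ϖ' i) = (∑ i, ϖ i) ∧
      DomRearrLE ϖ' ϖ ∧
      (∑ i : Fin (n - 1), m i * ((ϖ' (idxA i) - ϖ' (idxB i) : ℤ) : 𝕜)) ≠ 0 ∧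
      d = dotP mu ϖ - dotP lam ϖ'} L := by
  have hnonneg : ∀ i, 0 ≤ kk i := fun i => (hkk i).2 ⟨1, by simpa using hlam, by simpa using hle⟩
  have hlower : ∀ ϖ ϖ' : Fin n → ℤ, DomRearrLE ϖ' ϖ →
      (∑ i : Fin (n - 1), m i * ((ϖ' (idxA i) - ϖ' (idxB i) : ℤ) : 𝕜)) ≠ 0 →
      L ≤ dotP mu ϖ - dotP lam ϖ' := by
    intro ϖ ϖ' hdom hne
    obtain ⟨i, -, hi⟩ := exists_ne_zero_of_sum_ne_zero hne
    have hmi : m i ≠ 0 := left_ne_zero_of_mul hi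
    have hAB : ϖ' (idxA i) ≠ ϖ' (idxB i) := fun h => hi (by simp [h])
    exact (hL.2 ⟨i, hmi, rfl⟩).trans (le_dotP_sub_dotP hlam hmu (hnonneg i) (hkk i).1 hdom hAB)
  refine ⟨?_, ?_⟩
  · obtain ⟨i, hmi, hLi⟩ := hL.1
    obtain ⟨l, hl⟩ := exists_nat_extension lam
    obtain ⟨u, hu⟩ := exists_nat_extension mu
    obtain ⟨h, hh⟩ := exists_cartan_coordinates m
    have hnot : ¬ DomRearrLE (lam + (kk i + 1) • delta i) mu := fun hx => by
      have : kk i + 1 ≤ kk i := (hkk i).2 hx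
      omega
    obtain ⟨S, hS, hiS, hiS', hcost⟩ := exists_subset_cost_le hlam hle hl hu (hnonneg i) hnot
    obtain ⟨T, hT, hTcost, hTsum⟩ := exists_subset_cost_le_sum_ne_zero
      (fun s t hst ht => by
        simpa only [hl] using hlam ⟨s, by omega⟩ ⟨t, ht⟩ hst)
      (fun s t hst ht => by
        simpa only [hu] using hmu ⟨s, by omega⟩ ⟨t, ht⟩ hst)
      h L hS (show i.1 + 1 < n by omega) hiS hiS'
      (by rwa [sum_range_cartan_coordinates hh]) (hLi ▸ hcost)
    have hTn : range #T ⊆ range n := range_subset_range.2 (by simpa using card_le_card hT)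
    have hne : (∑ i : Fin (n - 1), m i *
        ((indicatorVec n T (idxA i) - indicatorVec n T (idxB i) : ℤ) : 𝕜)) ≠ 0 := by
      rwa [hh, sum_mul_indicatorVec hT]
    have hdom := domRearrLE_indicatorVec hT
    refine ⟨indicatorVec n (range #T), indicatorVec n T, WD_indicatorVec_range _ _, ?_, hdom, hne,
      le_antisymm (hlower _ _ hdom hne) ?_⟩
    · rw [sum_indicatorVec hT, sum_indicatorVec hTn, card_range]
    · have h1 := sum_mul_indicatorVec hTn u
      have h2 := sum_mul_indicatorVec hT l
      simp only [Int.cast_id] at h1 h2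
      simp only [dotP, hl, hu]
      rwa [h1, h2]
  · rintro d ⟨ϖ, ϖ', -, -, hdom, hne, rfl⟩
    exact hlower ϖ ϖ' hdom hne
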